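/- arXiv:2104.04401 — 3 statements merged into one kernel-verified Lean document; each statement's English description precedes it below -/
import Mathlib

section
/- Fix σ ∈ ℝ, β > 0 and λ ∈ ℝ. Let w be a positive smooth function on I_σ = (−∞,σ) belonging to H¹(I_σ,φ₁) (i.e. ∫_{−∞}^{σ} (w² + w'²) e^{−t²/2} dt < ∞) which satisfies −(w'(t) e^{−t²/2})' = λ e^{−t²/2} w(t) on I_σ, equivalently −w'' + t w' = λ w. Then lim_{t → −∞} w'(t) e^{−t²/2} = 0. -/
open MeasureTheory Real Set Filter Topology
open scoped RealInnerProductSpace NNReal ENNReal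

noncomputable section

/-- The density `φ_N` of the standard Gaussian measure on `ℝ^N`. -/
def gaussDensity (N : ℕ) (x : EuclideanSpace ℝ (Fin N)) : ℝ :=
  (2 * π) ^ (-(N : ℝ) / 2) * Real.exp (-‖x‖ ^ 2 / 2)

/-- The Gaussian measure `γ_N(A) = ∫_A φ_N dx`. -/
def gaussVol (N : ℕ) (A : Set (EuclideanSpace ℝ (Fin N))) : ℝ :=
  ∫ x in A, gaussDensity N x

/-- The `(N-1)`-dimensional Hausdorff measure on `ℝ^N`. -/
def hsurf (N : ℕ) : Measure (EuclideanSpace ℝ (Fin N)) :=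
  Measure.hausdorffMeasure ((N : ℝ) - 1)

/-- Membership in the weighted Sobolev space `H¹(Ω, φ_N)`:
`u` is differentiable in `Ω` and both `u` and `|∇u|` belong to `L²(Ω, φ_N)`. -/
def MemH1 (N : ℕ) (Ω : Set (EuclideanSpace ℝ (Fin N))) (u : EuclideanSpace ℝ (Fin N) → ℝ) : Prop :=
  (∀ x ∈ Ω, DifferentiableAt ℝ u x) ∧
    IntegrableOn (fun x => (u x) ^ 2 * gaussDensity N x) Ω volume ∧
    IntegrableOn (fun x => ‖gradient u x‖ ^ 2 * gaussDensity N x) Ω volume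

/-- The Rayleigh quotient `J[β, v]` for the Robin problem for the Hermite operator. -/
def rayleighQuot (N : ℕ) (Ω : Set (EuclideanSpace ℝ (Fin N))) (β : ℝ)
    (v : EuclideanSpace ℝ (Fin N) → ℝ) : ℝ :=
  ((∫ x in Ω, ‖gradient v x‖ ^ 2 * gaussDensity N x) +
      β * ∫ x in frontier Ω, (v x) ^ 2 * gaussDensity N x ∂(hsurf N)) /
    ∫ x in Ω, (v x) ^ 2 * gaussDensity N x

/-- The first Robin eigenvalue `λ₁(Ω)`, defined as the infimum of the Rayleigh quotient
over nonzero elements of `H¹(Ω, φ_N)`. -/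
def lambda1 (N : ℕ) (Ω : Set (EuclideanSpace ℝ (Fin N))) (β : ℝ) : ℝ :=
  sInf (rayleighQuot N Ω β ''
    {v | MemH1 N Ω v ∧ 0 < ∫ x in Ω, (v x) ^ 2 * gaussDensity N x})

/-- `Ω` is a Lipschitz domain: it is open, connected, and near every boundary point,
in a suitable direction `v`, `Ω` is the subgraph of a Lipschitz function. -/
def IsLipschitzDomain (N : ℕ) (Ω : Set (EuclideanSpace ℝ (Fin N))) : Prop :=
  IsOpen Ω ∧ IsConnected Ω ∧
    ∀ x ∈ frontier Ω, ∃ U : Set (EuclideanSpace ℝ (Fin N)), x ∈ U ∧ IsOpen U ∧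
      ∃ (v : EuclideanSpace ℝ (Fin N)) (f : EuclideanSpace ℝ (Fin N) → ℝ) (K : ℝ≥0),
        ‖v‖ = 1 ∧ LipschitzWith K f ∧
        Ω ∩ U = {y ∈ U | ⟪y, v⟫ < f (y - ⟪y, v⟫ • v)}

/-- `H¹(Ω, φ_N)` is compactly embedded in `L²(Ω, φ_N)`: every sequence bounded in the
`H¹(Ω,φ_N)` norm has a subsequence converging in `L²(Ω, φ_N)`. -/
def H1CompactlyEmbeddedInL2 (N : ℕ) (Ω : Set (EuclideanSpace ℝ (Fin N))) : Prop :=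
  ∀ u : ℕ → EuclideanSpace ℝ (Fin N) → ℝ, (∀ n, MemH1 N Ω (u n)) →
    (∃ C : ℝ, ∀ n,
      (∫ x in Ω, (u n x) ^ 2 * gaussDensity N x) +
        (∫ x in Ω, ‖gradient (u n) x‖ ^ 2 * gaussDensity N x) ≤ C) →
    ∃ (g : ℕ → ℕ) (v : EuclideanSpace ℝ (Fin N) → ℝ), StrictMono g ∧
      Tendsto (fun k => ∫ x in Ω, (u (g k) x - v x) ^ 2 * gaussDensity N x) atTop (𝓝 0)

/-- The trace operator `H¹(Ω,φ_N) → L²(∂Ω, φ_N)` is well defined. -/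
def TraceWellDefined (N : ℕ) (Ω : Set (EuclideanSpace ℝ (Fin N))) : Prop :=
  ∀ u, MemH1 N Ω u →
    IntegrableOn (fun x => (u x) ^ 2 * gaussDensity N x) (frontier Ω) (hsurf N)

/-- The trace operator `H¹(Ω,φ_N) → L²(∂Ω, φ_N)` is compact. -/
def TraceCompact (N : ℕ) (Ω : Set (EuclideanSpace ℝ (Fin N))) : Prop :=
  ∀ u : ℕ → EuclideanSpace ℝ (Fin N) → ℝ, (∀ n, MemH1 N Ω (u n)) →
    (∃ C : ℝ, ∀ n,
      (∫ x in Ω, (u n x) ^ 2 * gaussDensity N x) +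
        (∫ x in Ω, ‖gradient (u n) x‖ ^ 2 * gaussDensity N x) ≤ C) →
    ∃ (g : ℕ → ℕ) (v : EuclideanSpace ℝ (Fin N) → ℝ), StrictMono g ∧
      Tendsto (fun k => ∫ x in frontier Ω, (u (g k) x - v x) ^ 2 * gaussDensity N x ∂(hsurf N))
        atTop (𝓝 0)

/-- The class `𝒢` of admissible domains: Lipschitz domains with Gaussian measure in `(0,1)`
such that `H¹(Ω,φ_N)` is compactly embedded in `L²(Ω, φ_N)` and the trace operator into
`L²(∂Ω, φ_N)` is well defined and compact. -/
def GoodDomain (N : ℕ) (Ω : Set (EuclideanSpace ℝ (Fin N))) : Prop :=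
  IsLipschitzDomain N Ω ∧ gaussVol N Ω ∈ Ioo (0 : ℝ) 1 ∧
    H1CompactlyEmbeddedInL2 N Ω ∧ TraceWellDefined N Ω ∧ TraceCompact N Ω

/-- The half-space `S_a = {x ∈ ℝ^N : x₁ < a}`. -/
def halfSpace (N : ℕ) (hN : 0 < N) (a : ℝ) : Set (EuclideanSpace ℝ (Fin N)) :=
  {x | x ⟨0, hN⟩ < a}

/-- `u` is a (weak) eigenfunction of the Robin problem for the Hermite operator with
eigenvalue `lam`. -/
def IsEigenpair (N : ℕ) (Ω : Set (EuclideanSpace ℝ (Fin N))) (β lam : ℝ)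
    (u : EuclideanSpace ℝ (Fin N) → ℝ) : Prop :=
  MemH1 N Ω u ∧ (0 < ∫ x in Ω, (u x) ^ 2 * gaussDensity N x) ∧
    ∀ ψ, MemH1 N Ω ψ →
      (∫ x in Ω, ⟪gradient u x, gradient ψ x⟫ * gaussDensity N x) +
          β * (∫ x in frontier Ω, u x * ψ x * gaussDensity N x ∂(hsurf N)) =
        lam * ∫ x in Ω, u x * ψ x * gaussDensity N x

/-! ### One-dimensional objects -/

/-- Membership in the one-dimensional weighted Sobolev space `H¹(I_σ, φ₁)`. -/
def MemH1D (σ : ℝ) (v : ℝ → ℝ) : Prop :=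
  ContinuousOn v (Iic σ) ∧ (∀ t ∈ Iio σ, DifferentiableAt ℝ v t) ∧
    IntegrableOn (fun t => (v t) ^ 2 * Real.exp (-t ^ 2 / 2)) (Iio σ) volume ∧
    IntegrableOn (fun t => (deriv v t) ^ 2 * Real.exp (-t ^ 2 / 2)) (Iio σ) volume

/-- The one-dimensional Rayleigh quotient. -/
def rayleighQuot1D (σ β : ℝ) (v : ℝ → ℝ) : ℝ :=
  ((∫ t in Iio σ, (deriv v t) ^ 2 * Real.exp (-t ^ 2 / 2)) +
      β * (v σ) ^ 2 * Real.exp (-σ ^ 2 / 2)) /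
    ∫ t in Iio σ, (v t) ^ 2 * Real.exp (-t ^ 2 / 2)

/-- The first eigenvalue `λ₁(σ)` of the one-dimensional Hermite–Robin problem on
`I_σ = (-∞, σ)`. -/
def lambda1D (σ β : ℝ) : ℝ :=
  sInf (rayleighQuot1D σ β ''
    {v | MemH1D σ v ∧ 0 < ∫ t in Iio σ, (v t) ^ 2 * Real.exp (-t ^ 2 / 2)})

/-- `w` is a positive first eigenfunction of the one-dimensional Hermite–Robin problem
`-w'' + t w' = λ₁(σ) w` on `I_σ`, `w'(σ) + β w(σ) = 0`. -/
def Is1DFirstEigenfunction (σ β : ℝ) (w : ℝ → ℝ) : Prop :=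
  MemH1D σ w ∧ (∀ t ∈ Iio σ, 0 < w t) ∧
    (∀ t ∈ Iio σ, -(deriv (deriv w) t) + t * deriv w t = lambda1D σ β * w t) ∧
    deriv w σ + β * w σ = 0

/-! ### Level sets and the Bossel functional -/

/-- The super-level set `U_t = {x ∈ Ω : u(x) > t}`. -/
def superLevel (N : ℕ) (Ω : Set (EuclideanSpace ℝ (Fin N)))
    (u : EuclideanSpace ℝ (Fin N) → ℝ) (t : ℝ) : Set (EuclideanSpace ℝ (Fin N)) :=
  {x ∈ Ω | t < u x}

/-- The functional `F_Ω(U_t, ψ)`. -/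
def Ffun (N : ℕ) (Ω : Set (EuclideanSpace ℝ (Fin N))) (β : ℝ)
    (u : EuclideanSpace ℝ (Fin N) → ℝ) (t : ℝ) (ψ : EuclideanSpace ℝ (Fin N) → ℝ) : ℝ :=
  (gaussVol N (superLevel N Ω u t))⁻¹ *
    (-(∫ x in superLevel N Ω u t, (ψ x) ^ 2 * gaussDensity N x) +
      (∫ x in {x ∈ Ω | u x = t}, ψ x * gaussDensity N x ∂(hsurf N)) +
      β * (∫ x in {x ∈ frontier Ω | t < u x}, gaussDensity N x ∂(hsurf N)))

/-- If `f ^ 2` is integrable against the Gaussian weight on `s`, then so is `f`. -/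
theorem integrableOn_mul_gaussian_of_sq {s : Set ℝ} (hs : MeasurableSet s) {f : ℝ → ℝ}
    (hf : ContinuousOn f s)
    (hsq : IntegrableOn (fun t => (f t) ^ 2 * Real.exp (-t ^ 2 / 2)) s volume) :
    IntegrableOn (fun t => f t * Real.exp (-t ^ 2 / 2)) s volume := by
  have hg : IntegrableOn (fun t : ℝ => Real.exp (-t ^ 2 / 2)) s volume := by
    have h := (integrable_exp_neg_mul_sq (b := 1 / 2) (by norm_num)).integrableOn (s := s)
    refine h.congr_fun (fun t _ => ?_) hs
    ring_nf
  have hcont : Continuous fun t : ℝ => Real.exp (-t ^ 2 / 2) := by fun_prop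
  refine Integrable.mono' (hsq.add hg)
    ((hf.mul hcont.continuousOn).aestronglyMeasurable hs) (ae_of_all _ fun t => ?_)
  have hle : |f t| ≤ f t ^ 2 + 1 := by
    rw [abs_le]
    constructor <;> nlinarith [sq_nonneg (f t - 1), sq_nonneg (f t + 1)]
  rw [norm_mul, Real.norm_eq_abs, Real.norm_eq_abs, abs_of_pos (Real.exp_pos _)]
  simpa [add_mul] using mul_le_mul_of_nonneg_right hle (Real.exp_pos (-t ^ 2 / 2)).le

/-- **Decay of the weighted derivative.** If `w` is a positive smooth solution of
`-w'' + t w' = λ w` on `I_σ = (-∞,σ)` belonging to `H¹(I_σ, φ₁)`, then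
`w'(t) e^{-t²/2} → 0` as `t → -∞`. -/
theorem weighted_deriv_tendsto_zero_atBot (σ β lam : ℝ) (hβ : 0 < β) (w : ℝ → ℝ)
    (hsmooth : ContDiffOn ℝ (⊤ : ℕ∞) w (Iio σ)) (hpos : ∀ t ∈ Iio σ, 0 < w t)
    (hL2 : IntegrableOn (fun t => (w t) ^ 2 * Real.exp (-t ^ 2 / 2)) (Iio σ) volume)
    (hL2' : IntegrableOn (fun t => (deriv w t) ^ 2 * Real.exp (-t ^ 2 / 2)) (Iio σ) volume)
    (hode : ∀ t ∈ Iio σ, -(deriv (deriv w) t) + t * deriv w t = lam * w t) :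
    Tendsto (fun t => deriv w t * Real.exp (-t ^ 2 / 2)) atBot (𝓝 0) := by
  have hd : ContDiffOn ℝ (⊤ : ℕ∞) (deriv w) (Iio σ) :=
    hsmooth.deriv_of_isOpen isOpen_Iio le_rfl
  have hp := integrableOn_mul_gaussian_of_sq measurableSet_Iio hd.continuousOn hL2'
  have hq := (integrableOn_mul_gaussian_of_sq measurableSet_Iio hsmooth.continuousOn
    hL2).const_mul (-lam)
  have hsub : Iic (σ - 1) ⊆ Iio σ := Iic_subset_Iio.2 (by linarith)
  refine tendsto_zero_of_hasDerivAt_of_integrableOn_Iic (a := σ - 1) (fun t ht => ?_)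
    (IntegrableOn.mono_set hq hsub) (hp.mono_set hsub)
  have htσ : t ∈ Iio σ := hsub ht
  have hdd : HasDerivAt (deriv w) (deriv (deriv w) t) t :=
    ((hd.differentiableOn (by simp)).differentiableAt (isOpen_Iio.mem_nhds htσ)).hasDerivAt
  have he : HasDerivAt (fun t : ℝ => -t ^ 2 / 2) (-t) t := by
    refine (((hasDerivAt_id t).pow 2).neg.div_const 2).congr_deriv ?_
    simp only [id, Nat.cast_ofNat]
    ring
  refine (hdd.mul he.exp).congr_deriv ?_
  linear_combination -Real.exp (-t ^ 2 / 2) * hode t htσ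
end
end

section
/- Fix σ ∈ ℝ and λ > 0. Let w be a positive smooth function on I_σ = (−∞,σ) belonging to H¹(I_σ,φ₁) which satisfies −w'' + t w' = λ w on I_σ. Then w'(t) < 0 for all t ∈ I_σ, i.e. w is strictly decreasing on I_σ. -/
open MeasureTheory Real Set Filter Topology
open scoped RealInnerProductSpace NNReal ENNReal

noncomputable section

/-- A solution of the Hermite equation has flux derivative `-λ w e^{-t²/2}`. -/
theorem hasDerivAt_deriv_mul_gaussian {w : ℝ → ℝ} {lam t : ℝ}
    (hw : DifferentiableAt ℝ (deriv w) t)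
    (hode : -(deriv (deriv w) t) + t * deriv w t = lam * w t) :
    HasDerivAt (fun s => deriv w s * Real.exp (-s ^ 2 / 2))
      (-(lam * w t * Real.exp (-t ^ 2 / 2))) t := by
  have hexp : HasDerivAt (fun s : ℝ => Real.exp (-s ^ 2 / 2))
      (Real.exp (-t ^ 2 / 2) * (-t)) t := by
    refine HasDerivAt.exp ?_
    exact ((hasDerivAt_pow 2 t).fun_neg.div_const 2).congr_deriv (by push_cast; ring)
  refine (hw.hasDerivAt.mul hexp).congr_deriv ?_
  rw [← hode]
  ring

/-- A positive lower bound on the flux `f e^{-t²/2}` near `-∞` contradicts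
`f ∈ L²(I_a, φ₁)`. -/
theorem not_integrableOn_sq_mul_gaussian_of_le {f : ℝ → ℝ} {a c : ℝ} (hc : 0 < c)
    (hf : ∀ t ∈ Iio a, c ≤ f t * Real.exp (-t ^ 2 / 2)) :
    ¬ IntegrableOn (fun t => f t ^ 2 * Real.exp (-t ^ 2 / 2)) (Iio a) volume := by
  intro hint
  have hconst : IntegrableOn (fun _ : ℝ => c ^ 2) (Iio a) volume := by
    refine Integrable.mono' hint aestronglyMeasurable_const ?_
    refine (ae_restrict_mem measurableSet_Iio).mono fun t ht => ?_
    have hle : Real.exp (-t ^ 2 / 2) ≤ 1 := Real.exp_le_one_iff.mpr (by nlinarith [sq_nonneg t])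
    have hsq : c ^ 2 ≤ (f t * Real.exp (-t ^ 2 / 2)) ^ 2 := pow_le_pow_left₀ hc.le (hf t ht) 2
    rw [Real.norm_of_nonneg (sq_nonneg c)]
    calc c ^ 2 ≤ f t ^ 2 * Real.exp (-t ^ 2 / 2) * Real.exp (-t ^ 2 / 2) := by
          rw [mul_assoc, ← sq, ← mul_pow]; exact hsq
      _ ≤ f t ^ 2 * Real.exp (-t ^ 2 / 2) := mul_le_of_le_one_right (by positivity) hle
  rw [integrableOn_const_iff] at hconst
  simp [hc.ne'] at hconst

/-- **Monotonicity of positive solutions.** If `λ > 0` and `w` is a positive smooth solution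
of `-w'' + t w' = λ w` on `I_σ = (-∞,σ)` belonging to `H¹(I_σ, φ₁)`, then `w' < 0` on `I_σ`,
i.e. `w` is strictly decreasing on `I_σ`. -/
theorem positive_solution_strictly_decreasing (σ lam : ℝ) (hlam : 0 < lam) (w : ℝ → ℝ)
    (hsmooth : ContDiffOn ℝ (⊤ : ℕ∞) w (Iio σ)) (hpos : ∀ t ∈ Iio σ, 0 < w t)
    (hL2 : IntegrableOn (fun t => (w t) ^ 2 * Real.exp (-t ^ 2 / 2)) (Iio σ) volume)
    (hL2' : IntegrableOn (fun t => (deriv w t) ^ 2 * Real.exp (-t ^ 2 / 2)) (Iio σ) volume)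
    (hode : ∀ t ∈ Iio σ, -(deriv (deriv w) t) + t * deriv w t = lam * w t) :
    ∀ t ∈ Iio σ, deriv w t < 0 := by
  have hdiff : ∀ t ∈ Iio σ, DifferentiableAt ℝ (deriv w) t := fun t ht =>
    ((hsmooth.deriv_of_isOpen (m := 1) isOpen_Iio (by norm_cast)).differentiableOn
      one_ne_zero).differentiableAt (isOpen_Iio.mem_nhds ht)
  have hder := fun t ht => hasDerivAt_deriv_mul_gaussian (hdiff t ht) (hode t ht)
  have hanti : StrictAntiOn (fun s => deriv w s * Real.exp (-s ^ 2 / 2)) (Iio σ) := by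
    refine strictAntiOn_of_deriv_neg (convex_Iio σ)
      (fun t ht => (hder t ht).continuousAt.continuousWithinAt) fun t ht => ?_
    rw [interior_Iio] at ht
    rw [(hder t ht).deriv]
    have := hpos t ht
    exact neg_neg_of_pos (by positivity)
  intro t ht
  by_contra! hnonneg
  have hlt : t - 1 < σ := (sub_one_lt t).trans ht
  have hflux : 0 < deriv w (t - 1) * Real.exp (-(t - 1) ^ 2 / 2) :=
    (mul_nonneg hnonneg (Real.exp_pos _).le).trans_lt (hanti hlt ht (sub_one_lt t))
  exact not_integrableOn_sq_mul_gaussian_of_le hflux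
    (fun s hs => (hanti (lt_trans hs hlt) hlt hs).le)
    (hL2'.mono_set (Iio_subset_Iio hlt.le))
end
end

section
/- Fix σ ∈ ℝ and β > 0. Let w be a positive first eigenfunction of the one-dimensional Hermite–Robin problem −w'' + t w' = λ₁(σ) w on I_σ = (−∞,σ), w'(σ) + β w(σ) = 0, with w ∈ H¹(I_σ,φ₁), and define β(t) = −w'(t)/w(t) for t ∈ I_σ. Then β(t) is positive and strictly increasing on I_σ, and β(σ) = β. -/
open MeasureTheory Real Set Filter Topology
open scoped RealInnerProductSpace NNReal ENNReal

noncomputable section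

theorem hasDerivAt_exp_neg_sq_half (t : ℝ) :
    HasDerivAt (fun s : ℝ => Real.exp (-s ^ 2 / 2)) (-t * Real.exp (-t ^ 2 / 2)) t := by
  have h : HasDerivAt (fun s : ℝ => -s ^ 2 / 2) (-t) t := by
    refine (((hasDerivAt_id' t).fun_pow 2).fun_neg.div_const 2).congr_deriv ?_
    push_cast
    ring
  exact h.exp.congr_deriv (mul_comm _ _)

theorem exists_hasDerivAt_of_continuousOn_Iio {σ : ℝ} {f : ℝ → ℝ} (hf : ContinuousOn f (Iio σ)) :
    ∃ F : ℝ → ℝ, ∀ t < σ, HasDerivAt F (f t) t := by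
  refine ⟨fun u => ∫ x in (σ - 1)..u, f x, fun t ht => ?_⟩
  refine intervalIntegral.integral_hasDerivAt_right ?_
    (hf.stronglyMeasurableAtFilter isOpen_Iio t ht) (hf.continuousAt (Iio_mem_nhds ht))
  refine (hf.mono fun x hx => ?_).intervalIntegrable
  have := hx.2
  exact lt_of_le_of_lt this (max_lt (by linarith) ht)

/-- If `f'` agrees to the right of `a` with a function continuous at `a`, then so does it at `a`. -/
theorem deriv_eq_of_eventuallyEq_nhdsGT {f f' G : ℝ → ℝ} {a : ℝ}
    (hf : ∀ᶠ t in 𝓝 a, HasDerivAt f (f' t) t) (hG : ContinuousAt G a)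
    (h : f' =ᶠ[𝓝[>] a] G) : f' a = G a := by
  have hlim : Tendsto (fun x => deriv f x) (𝓝[>] a) (𝓝 (G a)) := by
    refine (hG.tendsto.mono_left nhdsWithin_le_nhds).congr' ?_
    filter_upwards [h, nhdsWithin_le_nhds hf] with t ht ht'
    rw [← ht, ht'.deriv]
  have hr := hasDerivWithinAt_Ici_of_tendsto_deriv (s := {t | HasDerivAt f (f' t) t})
    (fun t ht => (HasDerivAt.differentiableAt ht).differentiableWithinAt)
    hf.self_of_nhds.continuousAt.continuousWithinAt (nhdsWithin_le_nhds hf) hlim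
  exact (uniqueDiffWithinAt_Ici a).eq_deriv _ hf.self_of_nhds.hasDerivWithinAt hr

/-- If `f'` agrees to the left of `a` with a function continuous at `a`, then so does it at `a`. -/
theorem deriv_eq_of_eventuallyEq_nhdsLT {f f' G : ℝ → ℝ} {a : ℝ}
    (hf : ∀ᶠ t in 𝓝 a, HasDerivAt f (f' t) t) (hG : ContinuousAt G a)
    (h : f' =ᶠ[𝓝[<] a] G) : f' a = G a := by
  have hlim : Tendsto (fun x => deriv f x) (𝓝[<] a) (𝓝 (G a)) := by
    refine (hG.tendsto.mono_left nhdsWithin_le_nhds).congr' ?_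
    filter_upwards [h, nhdsWithin_le_nhds hf] with t ht ht'
    rw [← ht, ht'.deriv]
  have hr := hasDerivWithinAt_Iic_of_tendsto_deriv (s := {t | HasDerivAt f (f' t) t})
    (fun t ht => (HasDerivAt.differentiableAt ht).differentiableWithinAt)
    hf.self_of_nhds.continuousAt.continuousWithinAt (nhdsWithin_le_nhds hf) hlim
  exact (uniqueDiffWithinAt_Iic a).eq_deriv _ hf.self_of_nhds.hasDerivWithinAt hr

/-- A positive function `w` with derivative `g` on `(-∞, σ)` satisfying `w'' = t w' - lam w`, where
`w''` is read as `0` at points where `g` is not differentiable; `W` is a primitive of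
`lam w exp (-t² / 2)`. -/
structure IsJunkHermiteSolution (σ lam : ℝ) (w g W : ℝ → ℝ) : Prop where
  nonneg : 0 ≤ lam
  pos : ∀ t < σ, 0 < w t
  hasDerivAt : ∀ t < σ, HasDerivAt w (g t) t
  primitive : ∀ t < σ, HasDerivAt W (lam * w t * Real.exp (-t ^ 2 / 2)) t
  ode : ∀ t < σ, HasDerivAt g (t * g t - lam * w t) t ∨
    ¬ DifferentiableAt ℝ g t ∧ t * g t = lam * w t

namespace IsJunkHermiteSolution

variable {σ lam a b c t : ℝ} {w g W : ℝ → ℝ}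

theorem eventually_hasDerivAt (h : IsJunkHermiteSolution σ lam w g W) (ht : t < σ) :
    ∀ᶠ s in 𝓝 t, HasDerivAt w (g s) s :=
  Filter.mem_of_superset (Iio_mem_nhds ht) fun s hs => h.hasDerivAt s hs

theorem exists_eq_flux (h : IsJunkHermiteSolution σ lam w g W) (hab : a < b) (hb : b < σ)
    (hg : ∀ t ∈ Ioo a b, HasDerivAt g (t * g t - lam * w t) t) :
    ∃ c, ∀ t ∈ Icc a b, g t = (c - W t) / Real.exp (-t ^ 2 / 2) := by
  obtain ⟨m, hm⟩ : (Ioo a b).Nonempty := nonempty_Ioo.2 hab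
  have hD : ∀ t ∈ Ioo a b, HasDerivAt (fun s => g s * Real.exp (-s ^ 2 / 2) + W s) 0 t := by
    intro t ht
    refine (((hg t ht).fun_mul (hasDerivAt_exp_neg_sq_half t)).fun_add
      (h.primitive t (ht.2.trans hb))).congr_deriv ?_
    ring
  have hI : ∀ t ∈ Ioo a b, g t =
      (g m * Real.exp (-m ^ 2 / 2) + W m - W t) / Real.exp (-t ^ 2 / 2) := by
    intro t ht
    have := isOpen_Ioo.is_const_of_deriv_eq_zero isPreconnected_Ioo
      (fun x hx => (hD x hx).differentiableAt.differentiableWithinAt)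
      (fun x hx => (hD x hx).deriv) ht hm
    rw [eq_div_iff (Real.exp_pos _).ne']
    linarith
  have hcont : ∀ t < σ, ContinuousAt (fun t =>
      (g m * Real.exp (-m ^ 2 / 2) + W m - W t) / Real.exp (-t ^ 2 / 2)) t := fun t ht =>
    (continuousAt_const.sub (h.primitive t ht).continuousAt).div
      (hasDerivAt_exp_neg_sq_half t).continuousAt (Real.exp_pos _).ne'
  refine ⟨g m * Real.exp (-m ^ 2 / 2) + W m, fun t ht => ?_⟩
  rcases ht.1.eq_or_lt with rfl | hat
  · refine deriv_eq_of_eventuallyEq_nhdsGT (h.eventually_hasDerivAt (hab.trans hb))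
      (hcont a (hab.trans hb)) ?_
    filter_upwards [Ioo_mem_nhdsGT hab] with s hs using hI s hs
  rcases ht.2.eq_or_lt with rfl | htb
  · refine deriv_eq_of_eventuallyEq_nhdsLT (h.eventually_hasDerivAt hb) (hcont t hb) ?_
    filter_upwards [Ioo_mem_nhdsLT hab] with s hs using hI s hs
  exact hI t ⟨hat, htb⟩

theorem ode_of_ne (h : IsJunkHermiteSolution σ lam w g W) (ht : t < σ)
    (hne : t * g t ≠ lam * w t) : HasDerivAt g (t * g t - lam * w t) t :=
  (h.ode t ht).resolve_right fun h' => hne h'.2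

theorem eventually_ne (h : IsJunkHermiteSolution σ lam w g W) (ht : t < σ)
    (hne : t * g t ≠ lam * w t) : ∀ᶠ s in 𝓝 t, s * g s ≠ lam * w s :=
  (continuousAt_id.mul (h.ode_of_ne ht hne).continuousAt).ne_iff_eventually_ne
    (continuousAt_const.mul (h.hasDerivAt t ht).continuousAt) |>.1 hne

theorem not_forall_ne (h : IsJunkHermiteSolution σ lam w g W) (hab : a < b) (hb : b < σ)
    (h0 : 0 < a ∨ b < 0) (hZa : a * g a = lam * w a) (hZb : b * g b = lam * w b) :
    ¬ ∀ t ∈ Ioo a b, t * g t ≠ lam * w t := by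
  intro hne
  have hg : ∀ t ∈ Ioo a b, HasDerivAt g (t * g t - lam * w t) t :=
    fun t ht => h.ode_of_ne (ht.2.trans hb) (hne t ht)
  obtain ⟨c, hc⟩ := h.exists_eq_flux hab hb hg
  have hlt : ∀ t ∈ Icc a b, t < σ := fun t ht => ht.2.trans_lt hb
  have hWc : ContinuousOn W (Icc a b) := fun t ht =>
    (h.primitive t (hlt t ht)).continuousAt.continuousWithinAt
  have hEc : Continuous fun t : ℝ => Real.exp (-t ^ 2 / 2) := by fun_prop
  have hgc : ContinuousOn g (Icc a b) :=
    ((continuousOn_const.sub hWc).div hEc.continuousOn fun t _ => (Real.exp_pos _).ne').congr hc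
  have hwc : ContinuousOn w (Icc a b) := fun t ht =>
    (h.hasDerivAt t (hlt t ht)).continuousAt.continuousWithinAt
  set q : ℝ → ℝ := fun t => (t * g t - lam * w t) * Real.exp (-t ^ 2 / 2) with hq
  have hqc : ContinuousOn q (Icc a b) :=
    ((continuousOn_id.mul hgc).sub (continuousOn_const.mul hwc)).mul hEc.continuousOn
  have hqd : ∀ t ∈ Ioo a b,
      HasDerivAt q ((1 - lam) * g t * Real.exp (-t ^ 2 / 2)) t := by
    intro t ht
    refine ((((hasDerivAt_id' t).fun_mul (hg t ht)).fun_sub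
      ((h.hasDerivAt t (ht.2.trans hb)).const_mul lam)).fun_mul
      (hasDerivAt_exp_neg_sq_half t)).congr_deriv ?_
    ring
  have hqa : q a = 0 := by simp [hq, hZa]
  have hqb : q b = 0 := by simp [hq, hZb]
  obtain ⟨ξ, hξ, hξ0⟩ := exists_hasDerivAt_eq_zero hab hqc (hqa.trans hqb.symm) hqd
  rcases mul_eq_zero.1 ((mul_eq_zero.1 hξ0).resolve_right (Real.exp_pos _).ne') with h1 | hgξ
  · obtain ⟨η, -, hη⟩ := exists_hasDerivAt_eq_slope q _ hξ.1
      (hqc.mono (Icc_subset_Icc_right hξ.2.le)) fun t ht => hqd t ⟨ht.1, ht.2.trans hξ.2⟩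
    rw [h1, zero_mul, zero_mul, hqa, sub_zero, eq_comm,
      div_eq_zero_iff, or_iff_left (sub_pos.2 hξ.1).ne'] at hη
    exact hne ξ hξ (sub_eq_zero.1 ((mul_eq_zero.1 hη).resolve_right (Real.exp_pos _).ne'))
  · have hlam : 0 < lam := h.nonneg.lt_of_ne fun h' => hne ξ hξ (by rw [hgξ, ← h']; ring)
    have hcξ : c = W ξ := by
      have := hc ξ (Ioo_subset_Icc_self hξ)
      rw [hgξ, eq_comm, div_eq_zero_iff, or_iff_left (Real.exp_pos _).ne'] at this
      linarith
    have hmono : StrictMonoOn W (Icc a b) := by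
      refine strictMonoOn_of_deriv_pos (convex_Icc a b) hWc fun t ht => ?_
      have ht' := hlt t (interior_subset ht)
      rw [(h.primitive t ht').deriv]
      have := h.pos t ht'
      positivity
    rcases h0 with h0 | h0
    · have h1 := hmono (Ioo_subset_Icc_self hξ) (right_mem_Icc.2 hab.le) hξ.2
      have h2 : g b < 0 := by
        rw [hc b (right_mem_Icc.2 hab.le)]
        exact div_neg_of_neg_of_pos (by linarith) (Real.exp_pos _)
      have h3 := mul_pos hlam (h.pos b hb)
      nlinarith
    · have h1 := hmono (left_mem_Icc.2 hab.le) (Ioo_subset_Icc_self hξ) hξ.1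
      have h2 : 0 < g a := by
        rw [hc a (left_mem_Icc.2 hab.le)]
        exact div_pos (by linarith) (Real.exp_pos _)
      have h3 := mul_pos hlam (h.pos a (hab.trans hb))
      nlinarith

theorem eq_of_mem_Ioo (h : IsJunkHermiteSolution σ lam w g W) (hb : b < σ)
    (h0 : 0 < a ∨ b < 0) (hZa : a * g a = lam * w a) (hZb : b * g b = lam * w b)
    (hc : c ∈ Ioo a b) : c * g c = lam * w c := by
  by_contra hne
  have hclosed : IsClosed {t | t ∈ Icc a b ∧ t * g t = lam * w t} := by
    rw [← isOpen_compl_iff, isOpen_iff_mem_nhds]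
    intro t ht
    by_cases hab : t ∈ Icc a b
    · have hne : t * g t ≠ lam * w t := fun h' => ht ⟨hab, h'⟩
      filter_upwards [h.eventually_ne (hab.2.trans_lt hb) hne] with s hs hs' using hs hs'.2
    · filter_upwards [isClosed_Icc.isOpen_compl.mem_nhds hab] with s hs hs' using hs hs'.1
  have hcab := Ioo_subset_Icc_self hc
  obtain ⟨a', ⟨⟨ha'1, hZa'⟩, ha'2⟩, ha'⟩ :=
    ((isCompact_Icc (a := a) (b := c)).inter_left hclosed).exists_isGreatest
      ⟨a, ⟨left_mem_Icc.2 (hc.1.trans hc.2).le, hZa⟩, left_mem_Icc.2 hc.1.le⟩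
  obtain ⟨b', ⟨⟨hb'1, hZb'⟩, hb'2⟩, hb'⟩ :=
    ((isCompact_Icc (a := c) (b := b)).inter_left hclosed).exists_isLeast
      ⟨b, ⟨right_mem_Icc.2 (hc.1.trans hc.2).le, hZb⟩, right_mem_Icc.2 hc.2.le⟩
  have hac : a' < c := ha'2.2.lt_of_ne fun h' => hne (h' ▸ hZa')
  have hcb : c < b' := hb'2.1.lt_of_ne fun h' => hne (h' ▸ hZb')
  refine h.not_forall_ne (hac.trans hcb) (hb'1.2.trans_lt hb)
    (h0.imp (fun h' => h'.trans_le ha'1.1) fun h' => hb'1.2.trans_lt h') hZa' hZb' ?_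
  intro t ht hZ
  have htab : t ∈ Icc a b := ⟨ha'1.1.trans ht.1.le, ht.2.le.trans hb'1.2⟩
  rcases le_total t c with htc | htc
  · exact ht.1.not_ge (ha' ⟨⟨htab, hZ⟩, htab.1, htc⟩)
  · exact ht.2.not_ge (hb' ⟨⟨htab, hZ⟩, htc, htab.2⟩)

theorem ode_of_eventually_eq (h : IsJunkHermiteSolution σ lam w g W) (ht : t < σ) (h0 : t ≠ 0)
    (hZ : ∀ᶠ s in 𝓝 t, s * g s = lam * w s) : HasDerivAt g (t * g t - lam * w t) t := by
  refine (h.ode t ht).resolve_right fun h' => h'.1 ?_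
  have hd : DifferentiableAt ℝ (fun s => lam * w s / s) t :=
    ((h.hasDerivAt t ht).differentiableAt.const_mul lam).div differentiableAt_id h0
  refine hd.congr_of_eventuallyEq ?_
  filter_upwards [hZ, isOpen_ne.mem_nhds h0] with s hs hs0
  rw [eq_div_iff hs0, ← hs, mul_comm]

theorem exists_ode_right (h : IsJunkHermiteSolution σ lam w g W) (ht : t < σ) :
    ∃ b, t < b ∧ b < σ ∧ ∀ s ∈ Ioo t b, HasDerivAt g (s * g s - lam * w s) s := by
  obtain ⟨b₀, htb, hbσ, hb0⟩ : ∃ b, t < b ∧ b < σ ∧ (0 ≤ t ∨ b < 0) := by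
    rcases lt_or_ge t 0 with h0 | h0
    · obtain ⟨b, hb, hb'⟩ := exists_between (lt_min ht h0)
      exact ⟨b, hb, hb'.trans_le (min_le_left _ _), .inr (hb'.trans_le (min_le_right _ _))⟩
    · obtain ⟨b, hb, hb'⟩ := exists_between ht
      exact ⟨b, hb, hb', .inl h0⟩
  by_cases hfar : ∃ b, t < b ∧ b ≤ b₀ ∧ ∀ s ∈ Ioo t b, s * g s ≠ lam * w s
  · obtain ⟨b, hb, hbb, hne⟩ := hfar
    exact ⟨b, hb, hbb.trans_lt hbσ, fun s hs =>
      h.ode_of_ne (hs.2.trans_le hbb |>.trans hbσ) (hne s hs)⟩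
  push Not at hfar
  obtain ⟨b, hb, hZb⟩ := hfar b₀ htb le_rfl
  have hZ : ∀ s ∈ Ioo t b, s * g s = lam * w s := by
    intro s hs
    obtain ⟨z, hz, hZz⟩ := hfar s hs.1 (hs.2.trans hb.2).le
    exact h.eq_of_mem_Ioo (hb.2.trans hbσ)
      (hb0.imp (fun h' => h'.trans_lt hz.1) fun h' => hb.2.trans h') hZz hZb ⟨hz.2, hs.2⟩
  refine ⟨b, hb.1, hb.2.trans hbσ, fun s hs => h.ode_of_eventually_eq
    (hs.2.trans (hb.2.trans hbσ)) ?_ (Filter.mem_of_superset (isOpen_Ioo.mem_nhds hs) hZ)⟩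
  rcases hb0 with h0 | h0
  · exact (h0.trans_lt hs.1).ne'
  · exact (hs.2.trans (hb.2.trans h0)).ne

theorem exists_ode_left (h : IsJunkHermiteSolution σ lam w g W) (ht : t < σ) :
    ∃ a, a < t ∧ ∀ s ∈ Ioo a t, HasDerivAt g (s * g s - lam * w s) s := by
  obtain ⟨a₀, hat, ha0⟩ : ∃ a, a < t ∧ (0 < a ∨ t ≤ 0) := by
    rcases lt_or_ge 0 t with h0 | h0
    · obtain ⟨a, ha, ha'⟩ := exists_between h0
      exact ⟨a, ha', .inl ha⟩
    · exact ⟨t - 1, by linarith, .inr h0⟩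
  by_cases hfar : ∃ a, a < t ∧ a₀ ≤ a ∧ ∀ s ∈ Ioo a t, s * g s ≠ lam * w s
  · obtain ⟨a, ha, -, hne⟩ := hfar
    exact ⟨a, ha, fun s hs => h.ode_of_ne (hs.2.trans ht) (hne s hs)⟩
  push Not at hfar
  obtain ⟨a, ha, hZa⟩ := hfar a₀ hat le_rfl
  have hZ : ∀ s ∈ Ioo a t, s * g s = lam * w s := by
    intro s hs
    obtain ⟨z, hz, hZz⟩ := hfar s hs.2 (ha.1.trans hs.1).le
    exact h.eq_of_mem_Ioo (hz.2.trans ht)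
      (ha0.imp (fun h' => h'.trans ha.1) fun h' => hz.2.trans_le h') hZa hZz ⟨hs.1, hz.1⟩
  refine ⟨a, ha.2, fun s hs => h.ode_of_eventually_eq (hs.2.trans ht) ?_
    (Filter.mem_of_superset (isOpen_Ioo.mem_nhds hs) hZ)⟩
  rcases ha0 with h0 | h0
  · exact (h0.trans (ha.1.trans hs.1)).ne'
  · exact (hs.2.trans_le h0).ne

/-- The equation holds classically: `g` is differentiable everywhere on `(-∞, σ)`. -/
theorem hasDerivAt_deriv (h : IsJunkHermiteSolution σ lam w g W) (ht : t < σ) :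
    HasDerivAt g (t * g t - lam * w t) t := by
  refine (h.ode t ht).resolve_right fun h' => h'.1 ?_
  obtain ⟨b, htb, hb, hbode⟩ := h.exists_ode_right ht
  obtain ⟨a, hat, haode⟩ := h.exists_ode_left ht
  obtain ⟨c, hc⟩ := h.exists_eq_flux htb hb hbode
  obtain ⟨c', hc'⟩ := h.exists_eq_flux hat ht haode
  have hcc : c' = c := by
    have := (hc' t (right_mem_Icc.2 hat.le)).symm.trans (hc t (left_mem_Icc.2 htb.le))
    rw [div_left_inj' (Real.exp_pos _).ne'] at this
    linarith
  subst hcc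
  have hd : DifferentiableAt ℝ (fun s => (c' - W s) / Real.exp (-s ^ 2 / 2)) t :=
    ((differentiableAt_const c').sub (h.primitive t ht).differentiableAt).div
      (hasDerivAt_exp_neg_sq_half t).differentiableAt (Real.exp_pos _).ne'
  refine hd.congr_of_eventuallyEq ?_
  filter_upwards [Icc_mem_nhds hat htb] with s hs
  rcases le_total s t with hst | hst
  · exact hc' s ⟨hs.1, hst⟩
  · exact hc s ⟨hst, hs.2⟩

end IsJunkHermiteSolution

theorem exists_lt_of_integrableOn_Iio {σ c t₁ : ℝ} {f : ℝ → ℝ} (hf : IntegrableOn f (Iio σ))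
    (hc : 0 < c) (ht₁ : t₁ ≤ σ) : ∃ t < t₁, f t < c := by
  by_contra! hge
  have hconst : IntegrableOn (fun _ : ℝ => c) (Iio t₁) := by
    refine (hf.mono_set (Iio_subset_Iio ht₁)).mono' aestronglyMeasurable_const ?_
    refine (ae_restrict_mem measurableSet_Iio).mono fun t ht => ?_
    rw [Real.norm_of_nonneg hc.le]
    exact hge t ht
  rw [integrableOn_const_iff] at hconst
  simp [hc.ne'] at hconst

theorem strictMonoOn_Iio_of_hasDerivAt_pos {σ : ℝ} {f f' : ℝ → ℝ}
    (hf : ∀ t < σ, HasDerivAt f (f' t) t) (hpos : ∀ t < σ, 0 < f' t) :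
    StrictMonoOn f (Iio σ) :=
  strictMonoOn_of_deriv_pos (convex_Iio σ)
    (fun t ht => (hf t ht).continuousAt.continuousWithinAt) fun t ht => by
      rw [interior_Iio] at ht
      rw [(hf t ht).deriv]
      exact hpos t ht

/-- A positive function `w` with derivative `g` on `(-∞, σ)` solving `w'' = t w' - lam w`,
with `w` and `g` square integrable for the Gaussian weight. -/
structure IsHermiteSolution (σ lam : ℝ) (w g : ℝ → ℝ) : Prop where
  pos : ∀ t < σ, 0 < w t
  hasDerivAt : ∀ t < σ, HasDerivAt w (g t) t
  ode : ∀ t < σ, HasDerivAt g (t * g t - lam * w t) t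
  integrable_sq : IntegrableOn (fun t => w t ^ 2 * Real.exp (-t ^ 2 / 2)) (Iio σ)
  integrable_deriv_sq : IntegrableOn (fun t => g t ^ 2 * Real.exp (-t ^ 2 / 2)) (Iio σ)

namespace IsHermiteSolution

variable {σ lam t : ℝ} {w g : ℝ → ℝ}

theorem hasDerivAt_flux (h : IsHermiteSolution σ lam w g) (ht : t < σ) :
    HasDerivAt (fun s => -g s * Real.exp (-s ^ 2 / 2)) (lam * w t * Real.exp (-t ^ 2 / 2)) t := by
  refine ((h.ode t ht).fun_neg.fun_mul (hasDerivAt_exp_neg_sq_half t)).congr_deriv ?_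
  ring

/-- The flux `-g exp (-t² / 2)` of a square integrable solution cannot dominate an exponential
near `-∞`. -/
theorem exists_flux_lt (h : IsHermiteSolution σ lam w g) {C k t₁ : ℝ} (hC : 0 < C)
    (ht₁ : t₁ ≤ σ) : ∃ t < t₁, |-g t * Real.exp (-t ^ 2 / 2)| < C * Real.exp (k * t) := by
  obtain ⟨t, ht, hlt⟩ := exists_lt_of_integrableOn_Iio h.integrable_deriv_sq
    (c := C ^ 2 * Real.exp (-2 * k ^ 2)) (by positivity) ht₁
  refine ⟨t, ht, abs_lt_of_sq_lt_sq ?_ (by positivity)⟩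
  have hE : Real.exp (-2 * k ^ 2) * Real.exp (-t ^ 2 / 2) ≤ Real.exp (k * t) ^ 2 := by
    rw [← Real.exp_add, ← Real.exp_nat_mul, Real.exp_le_exp]
    push_cast
    nlinarith [sq_nonneg (t + 2 * k)]
  calc (-g t * Real.exp (-t ^ 2 / 2)) ^ 2
      = g t ^ 2 * Real.exp (-t ^ 2 / 2) * Real.exp (-t ^ 2 / 2) := by ring
    _ < C ^ 2 * Real.exp (-2 * k ^ 2) * Real.exp (-t ^ 2 / 2) :=
      mul_lt_mul_of_pos_right hlt (Real.exp_pos _)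
    _ = C ^ 2 * (Real.exp (-2 * k ^ 2) * Real.exp (-t ^ 2 / 2)) := by ring
    _ ≤ C ^ 2 * Real.exp (k * t) ^ 2 := mul_le_mul_of_nonneg_left hE (sq_nonneg C)
    _ = (C * Real.exp (k * t)) ^ 2 := by ring

theorem deriv_eq_zero (h : IsHermiteSolution σ 0 w g) (ht : t < σ) : g t = 0 := by
  by_contra hne
  obtain ⟨s, hs, hlt⟩ := h.exists_flux_lt (k := 0)
    (abs_pos.2 (mul_ne_zero (neg_ne_zero.2 hne) (Real.exp_pos (-t ^ 2 / 2)).ne')) ht.le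
  have hd : ∀ x ∈ Iio σ, HasDerivAt (fun s => -g s * Real.exp (-s ^ 2 / 2)) 0 x :=
    fun x hx => (h.hasDerivAt_flux hx).congr_deriv (by ring)
  have := isOpen_Iio.is_const_of_deriv_eq_zero isPreconnected_Iio
    (fun x hx => (hd x hx).differentiableAt.differentiableWithinAt)
    (fun x hx => (hd x hx).deriv) (hs.trans ht) ht
  rw [this] at hlt
  simp at hlt

theorem deriv_neg (h : IsHermiteSolution σ lam w g) (hlam : 0 < lam) (ht : t < σ) : g t < 0 := by
  by_contra! hge
  have hmono := strictMonoOn_Iio_of_hasDerivAt_pos (fun t ht => h.hasDerivAt_flux ht)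
    fun t ht => mul_pos (mul_pos hlam (h.pos t ht)) (Real.exp_pos _)
  have h1 : -g (t - 1) * Real.exp (-(t - 1) ^ 2 / 2) < 0 := by
    refine (hmono (show t - 1 < σ by linarith) ht (by linarith)).trans_le ?_
    exact mul_nonpos_of_nonpos_of_nonneg (by linarith) (Real.exp_pos _).le
  obtain ⟨s, hs, hlt⟩ := h.exists_flux_lt (k := 0) (abs_pos.2 h1.ne)
    (show t - 1 ≤ σ by linarith)
  have h2 := hmono (show s < σ by linarith) (show t - 1 < σ by linarith) hs
  simp only at h2
  rw [abs_of_neg h1, abs_of_neg (h2.trans h1), zero_mul, Real.exp_zero, mul_one] at hlt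
  linarith

theorem hasDerivAt_logDeriv (h : IsHermiteSolution σ lam w g) (ht : t < σ) :
    HasDerivAt (fun s => -g s / w s) ((g t ^ 2 - t * w t * g t + lam * w t ^ 2) / w t ^ 2) t := by
  refine ((h.ode t ht).fun_neg.fun_div (h.hasDerivAt t ht) (h.pos t ht).ne').congr_deriv ?_
  ring

theorem hasDerivAt_wronskian (h : IsHermiteSolution σ lam w g) (ht : t < σ) :
    HasDerivAt (fun s => (g s ^ 2 - s * w s * g s + lam * w s ^ 2) * Real.exp (-s ^ 2 / 2))
      (-(w t * g t) * Real.exp (-t ^ 2 / 2)) t := by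
  have hw := h.hasDerivAt t ht
  have hg := h.ode t ht
  refine ((((hg.fun_pow 2).fun_sub (((hasDerivAt_id' t).fun_mul hw).fun_mul hg)).fun_add
    ((hw.fun_pow 2).const_mul lam)).fun_mul (hasDerivAt_exp_neg_sq_half t)).congr_deriv ?_
  push_cast
  ring

theorem wronskian_pos (h : IsHermiteSolution σ lam w g) (hlam : 0 < lam) (ht : t < σ) :
    0 < g t ^ 2 - t * w t * g t + lam * w t ^ 2 := by
  by_contra! hle
  have hmono := strictMonoOn_Iio_of_hasDerivAt_pos (fun t ht => h.hasDerivAt_wronskian ht)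
    fun t ht => mul_pos (neg_pos.2 (mul_neg_of_pos_of_neg (h.pos t ht) (h.deriv_neg hlam ht)))
      (Real.exp_pos _)
  have hneg : ∀ s < t, g s ^ 2 - s * w s * g s + lam * w s ^ 2 < 0 := by
    intro s hs
    refine neg_of_mul_neg_left ((hmono (hs.trans ht) ht hs).trans_le ?_) (Real.exp_pos _).le
    exact mul_nonpos_of_nonpos_of_nonneg hle (Real.exp_pos _).le
  have hanti := strictMonoOn_Iio_of_hasDerivAt_pos (σ := t)
    (fun s hs => (h.hasDerivAt_logDeriv (hs.trans ht)).fun_neg) fun s hs =>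
      neg_pos.2 (div_neg_of_neg_of_pos (hneg s hs) (pow_pos (h.pos s (hs.trans ht)) 2))
  set t₁ := t - 1 with ht₁
  have ht₁t : t₁ < t := by linarith
  have ht₁σ : t₁ < σ := ht₁t.trans ht
  set c := -g t₁ / w t₁ with hc
  have hcpos : 0 < c := div_pos (neg_pos.2 (h.deriv_neg hlam ht₁σ)) (h.pos t₁ ht₁σ)
  have hwg : ∀ s < t₁, c * w s ≤ -g s := by
    intro s hs
    have := hanti (hs.trans ht₁t) ht₁t hs
    rw [← le_div_iff₀ (h.pos s (hs.trans ht₁σ))]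
    linarith
  set k := lam / c with hk
  have hd : ∀ s < σ, HasDerivAt (fun s => -g s * Real.exp (-s ^ 2 / 2) * Real.exp (-(k * s)))
      ((lam * w s + k * g s) * Real.exp (-s ^ 2 / 2) * Real.exp (-(k * s))) s := by
    intro s hs
    refine ((h.hasDerivAt_flux hs).fun_mul
      ((hasDerivAt_id' s).const_mul k).fun_neg.exp).congr_deriv ?_
    ring
  have hM : AntitoneOn (fun s => -g s * Real.exp (-s ^ 2 / 2) * Real.exp (-(k * s)))
      (Iic t₁) := by
    refine antitoneOn_of_deriv_nonpos (convex_Iic t₁)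
      (fun s hs => (hd s (lt_of_le_of_lt hs ht₁σ)).continuousAt.continuousWithinAt)
      (fun s hs => (hd s (lt_of_le_of_lt (interior_subset hs : s ∈ Iic t₁) ht₁σ)).differentiableAt
        |>.differentiableWithinAt) fun s hs => ?_
    rw [interior_Iic] at hs
    rw [(hd s (lt_trans hs ht₁σ)).deriv]
    refine mul_nonpos_of_nonpos_of_nonneg (mul_nonpos_of_nonpos_of_nonneg ?_
      (Real.exp_pos _).le) (Real.exp_pos _).le
    have h1 := mul_le_mul_of_nonneg_left (hwg s hs) (div_pos hlam hcpos).le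
    rw [← mul_assoc, div_mul_cancel₀ _ hcpos.ne'] at h1
    linarith
  have hflux : ∀ s < σ, 0 < -g s * Real.exp (-s ^ 2 / 2) := fun s hs =>
    mul_pos (neg_pos.2 (h.deriv_neg hlam hs)) (Real.exp_pos _)
  obtain ⟨s, hs, hlt⟩ := h.exists_flux_lt (k := k)
    (mul_pos (hflux t₁ ht₁σ) (Real.exp_pos (-(k * t₁)))) ht₁σ.le
  have h1 := hM hs.le self_mem_Iic hs.le
  rw [abs_of_pos (hflux s (hs.trans ht₁σ))] at hlt
  have h2 := mul_le_mul_of_nonneg_right h1 (Real.exp_pos (k * s)).le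
  simp only at h2
  rw [mul_assoc (-g s * _), ← Real.exp_add, neg_add_cancel, Real.exp_zero, mul_one] at h2
  linarith

theorem strictMonoOn_logDeriv (h : IsHermiteSolution σ lam w g) (hlam : 0 < lam) :
    StrictMonoOn (fun t => -g t / w t) (Iio σ) :=
  strictMonoOn_Iio_of_hasDerivAt_pos (fun _ ht => h.hasDerivAt_logDeriv ht)
    fun t ht => div_pos (h.wronskian_pos hlam ht) (pow_pos (h.pos t ht) 2)

/-- The energy inequality obtained by testing the equation against `w` itself. -/
theorem integral_deriv_sq_le (h : IsHermiteSolution σ lam w g) (hlam : 0 < lam) :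
    ∫ t in Iio σ, g t ^ 2 * Real.exp (-t ^ 2 / 2) ≤
      lam * ∫ t in Iio σ, w t ^ 2 * Real.exp (-t ^ 2 / 2) := by
  set f : ℝ → ℝ := fun t =>
    g t ^ 2 * Real.exp (-t ^ 2 / 2) - lam * (w t ^ 2 * Real.exp (-t ^ 2 / 2)) with hf
  have hfi : IntegrableOn f (Iio σ) := h.integrable_deriv_sq.sub (h.integrable_sq.const_mul lam)
  have hF : ∀ t < σ, HasDerivAt (fun t => w t * g t * Real.exp (-t ^ 2 / 2)) (f t) t := by
    intro t ht
    refine (((h.hasDerivAt t ht).fun_mul (h.ode t ht)).fun_mul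
      (hasDerivAt_exp_neg_sq_half t)).congr_deriv ?_
    simp only [hf]
    ring
  have hFi : IntegrableOn (fun t => -(w t * g t * Real.exp (-t ^ 2 / 2))) (Iio σ) := by
    refine Integrable.neg (Integrable.mono' (h.integrable_sq.add h.integrable_deriv_sq)
      (ContinuousOn.aestronglyMeasurable (fun t ht => (hF t ht).continuousAt.continuousWithinAt)
        measurableSet_Iio) (ae_of_all _ fun t => ?_))
    rw [Real.norm_eq_abs, abs_mul, Real.abs_exp, Pi.add_apply, ← add_mul]
    refine mul_le_mul_of_nonneg_right (abs_le.2 ⟨?_, ?_⟩) (Real.exp_pos _).le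
    · nlinarith [sq_nonneg (w t + g t), sq_nonneg (w t), sq_nonneg (g t)]
    · nlinarith [sq_nonneg (w t - g t), sq_nonneg (w t), sq_nonneg (g t)]
  have hIic : ∀ b < σ, ∫ t in Iic b, f t ≤ 0 := by
    intro b hb
    have hfb := hfi.mono_set (Iic_subset_Iio.2 hb)
    refine le_of_forall_pos_le_add fun ε hε => ?_
    rw [zero_add]
    refine le_of_tendsto_of_frequently (intervalIntegral_tendsto_integral_Iic b hfb tendsto_id)
      (frequently_atBot.2 fun a => ?_)
    obtain ⟨t, ht, hlt⟩ := exists_lt_of_integrableOn_Iio hFi hε ((min_le_right a b).trans hb.le)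
    have htb : t ≤ b := (ht.trans_le (min_le_right a b)).le
    refine ⟨t, (ht.trans_le (min_le_left a b)).le, ?_⟩
    rw [id, intervalIntegral.integral_eq_sub_of_hasDerivAt (fun x hx => hF x ?_)
      ((intervalIntegrable_iff_integrableOn_Ioc_of_le htb).2 (hfb.mono_set Ioc_subset_Iic_self))]
    · have := mul_neg_of_neg_of_pos (mul_neg_of_pos_of_neg (h.pos b hb) (h.deriv_neg hlam hb))
        (Real.exp_pos (-b ^ 2 / 2))
      linarith
    · rw [uIcc_of_le htb] at hx
      exact hx.2.trans_lt hb
  have hU : ⋃ n : ℕ, Iic (σ - 1 / ((n : ℝ) + 1)) = Iio σ := by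
    ext t
    simp only [mem_iUnion, mem_Iic, mem_Iio]
    constructor
    · rintro ⟨n, hn⟩
      have : (0 : ℝ) < 1 / ((n : ℝ) + 1) := by positivity
      linarith
    · intro ht
      obtain ⟨n, hn⟩ := exists_nat_one_div_lt (sub_pos.2 ht)
      exact ⟨n, by linarith⟩
  have hlim := tendsto_setIntegral_of_monotone (μ := volume) (f := f)
    (s := fun n : ℕ => Iic (σ - 1 / ((n : ℝ) + 1))) (fun _ => measurableSet_Iic)
    (fun m n hmn => Iic_subset_Iic.2 (sub_le_sub_left (Nat.one_div_le_one_div hmn) σ))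
    (by rwa [hU])
  have hle := le_of_tendsto' hlim fun n => hIic _ (sub_lt_self σ (by positivity))
  rw [hU, integral_sub h.integrable_deriv_sq (h.integrable_sq.const_mul lam),
    integral_const_mul] at hle
  linarith

end IsHermiteSolution

theorem rayleighQuot1D_nonneg {σ β : ℝ} (hβ : 0 ≤ β) (v : ℝ → ℝ) :
    0 ≤ rayleighQuot1D σ β v := by
  refine div_nonneg (add_nonneg (integral_nonneg fun t => ?_) ?_) (integral_nonneg fun t => ?_)
  all_goals positivity

theorem lambda1D_nonneg {σ β : ℝ} (hβ : 0 ≤ β) : 0 ≤ lambda1D σ β := by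
  refine Real.sInf_nonneg ?_
  rintro _ ⟨v, -, rfl⟩
  exact rayleighQuot1D_nonneg hβ v

theorem lambda1D_mul_le {σ β : ℝ} (hβ : 0 ≤ β) {v : ℝ → ℝ} (hv : MemH1D σ v)
    (hpos : 0 < ∫ t in Iio σ, v t ^ 2 * Real.exp (-t ^ 2 / 2)) :
    lambda1D σ β * ∫ t in Iio σ, v t ^ 2 * Real.exp (-t ^ 2 / 2) ≤
      (∫ t in Iio σ, deriv v t ^ 2 * Real.exp (-t ^ 2 / 2)) +
        β * v σ ^ 2 * Real.exp (-σ ^ 2 / 2) := by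
  have h : lambda1D σ β ≤ rayleighQuot1D σ β v :=
    csInf_le ⟨0, by rintro _ ⟨u, -, rfl⟩; exact rayleighQuot1D_nonneg hβ u⟩ ⟨v, ⟨hv, hpos⟩, rfl⟩
  rwa [rayleighQuot1D, le_div_iff₀ hpos] at h

theorem integrable_exp_neg_sq_half : Integrable fun t : ℝ => Real.exp (-t ^ 2 / 2) := by
  refine (integrable_exp_neg_mul_sq (b := 1 / 2) (by norm_num)).congr (ae_of_all _ fun t => ?_)
  ring_nf

theorem setIntegral_Iio_pos {σ : ℝ} {f : ℝ → ℝ} (hf : IntegrableOn f (Iio σ))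
    (hpos : ∀ t < σ, 0 < f t) : 0 < ∫ t in Iio σ, f t := by
  rw [setIntegral_pos_iff_support_of_nonneg_ae
    ((ae_restrict_mem measurableSet_Iio).mono fun t ht => (hpos t ht).le) hf,
    inter_eq_right.2 (show Iio σ ⊆ Function.support f from fun t ht => (hpos t ht).ne')]
  simp

namespace Is1DFirstEigenfunction

variable {σ β : ℝ} {w : ℝ → ℝ}

theorem isHermiteSolution (hβ : 0 ≤ β) (hw : Is1DFirstEigenfunction σ β w) :
    IsHermiteSolution σ (lambda1D σ β) w (deriv w) := by
  obtain ⟨⟨hcont, hdiff, hint, hint'⟩, hpos, hode, -⟩ := hw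
  obtain ⟨W, hW⟩ := exists_hasDerivAt_of_continuousOn_Iio
    (f := fun t => lambda1D σ β * w t * Real.exp (-t ^ 2 / 2)) (σ := σ)
    ((continuousOn_const.mul (hcont.mono Iio_subset_Iic_self)).mul (by fun_prop))
  have hjunk : IsJunkHermiteSolution σ (lambda1D σ β) w (deriv w) W := by
    refine ⟨lambda1D_nonneg hβ, hpos, fun t ht => (hdiff t ht).hasDerivAt, hW, fun t ht => ?_⟩
    have := hode t ht
    by_cases hd : DifferentiableAt ℝ (deriv w) t
    · exact .inl (hd.hasDerivAt.congr_deriv (by linarith))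
    · rw [deriv_zero_of_not_differentiableAt hd] at this
      exact .inr ⟨hd, by linarith⟩
  exact ⟨hpos, hjunk.hasDerivAt, fun t ht => hjunk.hasDerivAt_deriv ht, hint, hint'⟩

theorem lambda1D_pos (hβ : 0 < β) (hw : Is1DFirstEigenfunction σ β w) : 0 < lambda1D σ β := by
  refine (lambda1D_nonneg hβ.le).lt_of_ne fun h0 => ?_
  have h := hw.isHermiteSolution hβ.le
  rw [← h0] at h
  obtain ⟨⟨hcont, -, -, -⟩, hpos, -, hbc⟩ := hw
  have hconst : EqOn w (fun _ => w (σ - 1)) (Iio σ) := fun t ht =>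
    isOpen_Iio.is_const_of_deriv_eq_zero isPreconnected_Iio
      (fun x hx => (h.hasDerivAt x hx).differentiableAt.differentiableWithinAt)
      (fun x hx => h.deriv_eq_zero hx) ht (sub_one_lt σ)
  have hconst' : EqOn w (fun _ => w (σ - 1)) (Iic σ) :=
    hconst.of_subset_closure hcont continuousOn_const Iio_subset_Iic_self (by simp)
  have hσ : 0 < w σ := by
    rw [hconst' self_mem_Iic]
    exact hpos _ (sub_one_lt σ)
  have hne : deriv w σ ≠ 0 := by nlinarith
  refine hne ((uniqueDiffWithinAt_Iic σ).eq_deriv _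
    (differentiableAt_of_deriv_ne_zero hne).hasDerivAt.hasDerivWithinAt ?_)
  exact (hasDerivWithinAt_const σ (Iic σ) (w (σ - 1))).congr hconst' (hconst' self_mem_Iic)

/-- If `w` vanished at `σ`, then adding a small constant would lower its Rayleigh quotient. -/
theorem boundary_ne_zero (hβ : 0 < β) (hw : Is1DFirstEigenfunction σ β w) : w σ ≠ 0 := by
  intro hσ
  have hlam := hw.lambda1D_pos hβ
  have h := hw.isHermiteSolution hβ.le
  have henergy := h.integral_deriv_sq_le hlam
  have hE := integrable_exp_neg_sq_half.integrableOn (s := Iio σ)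
  obtain ⟨⟨hcont, hdiff, hint, hint'⟩, hpos, -, -⟩ := hw
  have hwE : IntegrableOn (fun t => w t * Real.exp (-t ^ 2 / 2)) (Iio σ) := by
    refine Integrable.mono' (hint.add hE) (ContinuousOn.aestronglyMeasurable
      ((hcont.mono Iio_subset_Iic_self).mul (by fun_prop)) measurableSet_Iio)
      (ae_of_all _ fun t => ?_)
    rw [Real.norm_eq_abs, abs_mul, Real.abs_exp, Pi.add_apply, ← add_one_mul]
    refine mul_le_mul_of_nonneg_right (abs_le.2 ⟨?_, ?_⟩) (Real.exp_pos _).le <;>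
      nlinarith [sq_nonneg (w t - 1), sq_nonneg (w t + 1)]
  have hB := setIntegral_Iio_pos hwE fun t ht => mul_pos (hpos t ht) (Real.exp_pos _)
  have hC := setIntegral_Iio_pos hE fun t _ => Real.exp_pos _
  have hA := setIntegral_Iio_pos hint fun t ht => mul_pos (pow_pos (hpos t ht) 2) (Real.exp_pos _)
  set A := ∫ t in Iio σ, w t ^ 2 * Real.exp (-t ^ 2 / 2)
  set B := ∫ t in Iio σ, w t * Real.exp (-t ^ 2 / 2)
  set C := ∫ t in Iio σ, Real.exp (-t ^ 2 / 2)
  set ε := lambda1D σ β * B / (β * Real.exp (-σ ^ 2 / 2)) with hε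
  have hεpos : 0 < ε := by positivity
  have hexpand : (fun t => (w t + ε) ^ 2 * Real.exp (-t ^ 2 / 2)) = fun t =>
      w t ^ 2 * Real.exp (-t ^ 2 / 2) + 2 * ε * (w t * Real.exp (-t ^ 2 / 2)) +
        ε ^ 2 * Real.exp (-t ^ 2 / 2) := by
    funext t
    ring
  have hi₁ : IntegrableOn (fun t => w t ^ 2 * Real.exp (-t ^ 2 / 2) +
      2 * ε * (w t * Real.exp (-t ^ 2 / 2))) (Iio σ) := hint.add (hwE.const_mul (2 * ε))
  have hi₂ := hE.const_mul (ε ^ 2)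
  have hD : ∫ t in Iio σ, (w t + ε) ^ 2 * Real.exp (-t ^ 2 / 2) =
      A + 2 * ε * B + ε ^ 2 * C := by
    rw [hexpand, integral_add hi₁ hi₂, integral_add hint (hwE.const_mul (2 * ε)),
      integral_const_mul, integral_const_mul]
  have hmem : MemH1D σ fun t => w t + ε := by
    refine ⟨hcont.add continuousOn_const, fun t ht => (hdiff t ht).add_const ε, ?_, ?_⟩
    · rw [hexpand]
      exact hi₁.add hi₂
    · simpa only [deriv_add_const] using hint'
  have hle := lambda1D_mul_le hβ.le hmem (by rw [hD]; positivity)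
  simp only [deriv_add_const, hσ, zero_add] at hle
  rw [hD] at hle
  have hεmul : β * ε ^ 2 * Real.exp (-σ ^ 2 / 2) = lambda1D σ β * B * ε := by
    rw [hε]
    field_simp
  have h1 : 0 < lambda1D σ β * B * ε := by positivity
  have h2 : 0 < lambda1D σ β * (ε ^ 2 * C) := by positivity
  nlinarith

end Is1DFirstEigenfunction

/-- **The logarithmic derivative `β(t) = -w'/w` is positive, strictly increasing, and matches
the Robin parameter at the boundary.** Here `w` is a positive first eigenfunction of the
one-dimensional Hermite–Robin problem on `I_σ = (-∞,σ)`. -/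
theorem betaFun_pos_strictMono_boundary (σ β : ℝ) (hβ : 0 < β) (w : ℝ → ℝ)
    (hw : Is1DFirstEigenfunction σ β w) :
    (∀ t ∈ Iio σ, 0 < -deriv w t / w t) ∧
      StrictMonoOn (fun t => -deriv w t / w t) (Iio σ) ∧
      -deriv w σ / w σ = β := by
  have hlam := hw.lambda1D_pos hβ
  have h := hw.isHermiteSolution hβ.le
  refine ⟨fun t ht => div_pos (neg_pos.2 (h.deriv_neg hlam ht)) (h.pos t ht),
    h.strictMonoOn_logDeriv hlam, ?_⟩
  rw [div_eq_iff (hw.boundary_ne_zero hβ)]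
  linarith [hw.2.2.2]
end
end
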